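/- Let (W,S) be a finite Coxeter system and let I ⊆ J ⊆ S. The map ψ : w ↦ w^I is a bijection from E_σ(I,J) to E_β(I,J), whose inverse is the map φ : u ↦ u · w_{∘,I}. -/

import Mathlib

open scoped Classical

namespace ShardBHZ

variable {B : Type*} {W : Type*} [Group W] {M : CoxeterMatrix B} (cs : CoxeterSystem M W)

/-- The support `S(w)` of `w`: the set of simple reflections appearing in some
(equivalently, any) reduced word for `w`. -/
def supp (w : W) : Set B := {i | ∃ l : List B, cs.IsReduced l ∧ cs.wordProd l = w ∧ i ∈ l}

/-- The standard parabolic subgroup `W_I` generated by the simple reflections in `I`. -/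
def parab (I : Set B) : Subgroup W := Subgroup.closure (cs.simple '' I)

/-- `x` has no right descent in `I`; this characterizes the minimal length coset
representatives `W^I` of `W / W_I`. -/
def IsMinRep (I : Set B) (x : W) : Prop := ∀ i ∈ I, ¬ cs.IsRightDescent x i

/-- The BHZ order: `u ≤_β v` iff the parabolic component `v_{S(u)}` equals `u`, i.e.
`v = (v * u⁻¹) * u` is the parabolic factorization of `v` with respect to `W_{S(u)}`:
`u ∈ W_{S(u)}`, `v * u⁻¹` has no right descent in `S(u)`, and lengths add. -/
def bhzLE (u v : W) : Prop :=
  u ∈ parab cs (supp cs u) ∧ IsMinRep cs (supp cs u) (v * u⁻¹) ∧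
    cs.length v = cs.length (v * u⁻¹) + cs.length u

/-- The set `N(w)` of left inversions of `w`. -/
def invSet (w : W) : Set W := {t | cs.IsLeftInversion w t}

/-- The subgroup `G(w)` generated by `w * s * w⁻¹` for `s` a right descent of `w`. -/
def descConj (w : W) : Subgroup W :=
  Subgroup.closure {x | ∃ i, cs.IsRightDescent w i ∧ x = w * cs.simple i * w⁻¹}

/-- The shard intersection order: `u ≤_σ v` iff `N(u) ⊆ N(v)` and `G(u) ⊆ G(v)`. -/
def shardLE (u v : W) : Prop := invSet cs u ⊆ invSet cs v ∧ descConj cs u ≤ descConj cs v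

/-- The parabolic component `w_I ∈ W_I` of `w` in the unique factorization
`w = w^I * w_I` with `w_I ∈ W_I`, `ℓ(w) = ℓ(w^I) + ℓ(w_I)` and `w^I` having no right
descent in `I`. -/
noncomputable def pLow (I : Set B) (w : W) : W :=
  Classical.epsilon (fun u => u ∈ parab cs I ∧ IsMinRep cs I (w * u⁻¹) ∧
    cs.length w = cs.length (w * u⁻¹) + cs.length u)

/-- The minimal length coset representative `w^I = w * (w_I)⁻¹`. -/
noncomputable def pHigh (I : Set B) (w : W) : W := w * (pLow cs I w)⁻¹

/-- The longest element `w_{∘,I}` of the parabolic subgroup `W_I`. -/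
noncomputable def longestElt (I : Set B) : W :=
  Classical.epsilon (fun x => x ∈ parab cs I ∧ ∀ y ∈ parab cs I, cs.length y ≤ cs.length x)

/-- `E_β(I,J) = {u ∈ W_J : u has no right descent in I and J \ I ⊆ S(u)}`. -/
def Eb (I J : Set B) : Set W :=
  {u | u ∈ parab cs J ∧ IsMinRep cs I u ∧ J \ I ⊆ supp cs u}

/-- `E_σ(I,J) = {w ∈ W_J : S(w) = J and I ⊆ D_R(w) ⊆ J}`. -/
def Es (I J : Set B) : Set W :=
  {w | w ∈ parab cs J ∧ supp cs w = J ∧ (∀ i ∈ I, cs.IsRightDescent w i) ∧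
    ∀ i : B, cs.IsRightDescent w i → i ∈ J}

/-- The action of a simple reflection on `W × ZMod 2` that conjugates the first component and
records in the second one whether it was the simple reflection itself. -/
noncomputable def signedConj (i : B) : Function.End (W × ZMod 2) :=
  fun p => (cs.simple i * p.1 * cs.simple i, p.2 + if p.1 = cs.simple i then 1 else 0)

theorem simple_mul_pow_mul_simple (i j : B) (k : ℕ) :
    cs.simple j * (cs.simple i * cs.simple j) ^ k * cs.simple j =
      ((cs.simple i * cs.simple j) ^ k)⁻¹ := by
  have h := conj_pow (i := k) (a := cs.simple j) (b := cs.simple i * cs.simple j)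
  rw [cs.inv_simple] at h
  rw [← h, ← inv_pow]
  simp [mul_assoc]

theorem conj_pow_eq_simple_mul_iff (i j : B) (k : ℕ) (t x : W) :
    (cs.simple i * cs.simple j) ^ k * t * ((cs.simple i * cs.simple j) ^ k)⁻¹ =
        cs.simple j * x ↔
      cs.simple j * t =
        (cs.simple i * cs.simple j) ^ k * x * (cs.simple i * cs.simple j) ^ k := by
  have h := simple_mul_pow_mul_simple cs i j k
  generalize (cs.simple i * cs.simple j) ^ k = p at *
  have hp : p⁻¹ * cs.simple j = cs.simple j * p := by rw [← h]; simp [mul_assoc]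
  rw [mul_inv_eq_iff_eq_mul, ← eq_inv_mul_iff_mul_eq, ← eq_inv_mul_iff_mul_eq (b := cs.simple j),
    cs.inv_simple]
  simp only [← mul_assoc, hp]

theorem end_mul_apply {α : Type*} (f g : Function.End α) (a : α) : (f * g) a = f (g a) := rfl

theorem end_one_apply {α : Type*} (a : α) : (1 : Function.End α) a = a := rfl

theorem signedConj_mul_pow_apply (i j : B) (k : ℕ) (t : W) (e : ZMod 2) :
    ((signedConj cs i * signedConj cs j) ^ k) (t, e) =
      ((cs.simple i * cs.simple j) ^ k * t * ((cs.simple i * cs.simple j) ^ k)⁻¹,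
        e + ∑ r ∈ Finset.range (2 * k),
          if cs.simple j * t = (cs.simple i * cs.simple j) ^ r then 1 else 0) := by
  induction k with
  | zero => simp [end_one_apply]
  | succ k ih =>
    have h1 := conj_pow_eq_simple_mul_iff cs i j k t 1
    have h2 := conj_pow_eq_simple_mul_iff cs i j k t (cs.simple i * cs.simple j)
    rw [mul_one, mul_one, ← pow_add, ← two_mul] at h1
    rw [← pow_succ, ← pow_add, show k + 1 + k = 2 * k + 1 by ring] at h2
    have h3 : cs.simple j * ((cs.simple i * cs.simple j) ^ k * t *
        ((cs.simple i * cs.simple j) ^ k)⁻¹) * cs.simple j = cs.simple i ↔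
        cs.simple j * t = (cs.simple i * cs.simple j) ^ (2 * k + 1) := by
      rw [← h2, ← eq_mul_inv_iff_mul_eq, ← eq_inv_mul_iff_mul_eq, cs.inv_simple]
    rw [pow_succ', end_mul_apply, ih, end_mul_apply]
    simp only [signedConj, h1, h3]
    rw [show 2 * (k + 1) = 2 * k + 1 + 1 by ring, Finset.sum_range_succ, Finset.sum_range_succ]
    refine Prod.ext ?_ ?_
    · simp [pow_succ', mul_assoc]
    · simp [add_assoc]

theorem isLiftable_signedConj : M.IsLiftable (signedConj cs) := by
  intro i j
  funext ⟨t, e⟩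
  rw [signedConj_mul_pow_apply, cs.simple_mul_simple_pow, two_mul, Finset.sum_range_add]
  simp [pow_add, ← two_mul, CharTwo.two_eq_zero, end_one_apply]

/-- The action of `W` on `W × ZMod 2` extending `signedConj`. -/
noncomputable def signedConjHom : W →* Function.End (W × ZMod 2) :=
  cs.lift ⟨signedConj cs, isLiftable_signedConj cs⟩

theorem signedConjHom_simple (i : B) : signedConjHom cs (cs.simple i) = signedConj cs i :=
  cs.lift_apply_simple (isLiftable_signedConj cs) i

theorem signedConjHom_wordProd (ω : List B) (t : W) (e : ZMod 2) :
    signedConjHom cs (cs.wordProd ω) (t, e) =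
      (cs.wordProd ω * t * (cs.wordProd ω)⁻¹, e + ((cs.rightInvSeq ω).count t : ℕ)) := by
  induction ω with
  | nil => simp [end_one_apply]
  | cons i ω ih =>
    have h : cs.wordProd ω * t * (cs.wordProd ω)⁻¹ = cs.simple i ↔
        (cs.wordProd ω)⁻¹ * cs.simple i * cs.wordProd ω = t := by
      rw [mul_inv_eq_iff_eq_mul, mul_assoc, inv_mul_eq_iff_eq_mul, eq_comm]
    rw [cs.wordProd_cons, map_mul, end_mul_apply, ih,
      signedConjHom_simple]
    simp only [signedConj, CoxeterSystem.rightInvSeq, List.count_cons, h, beq_iff_eq]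
    refine Prod.ext ?_ ?_
    · simp [mul_assoc]
    · simp [add_assoc]

theorem simple_mem_rightInvSeq {ω : List B} {i : B}
    (h : cs.IsRightDescent (cs.wordProd ω) i) : cs.simple i ∈ cs.rightInvSeq ω := by
  by_contra hmem
  obtain ⟨ω', hω', hprod⟩ := cs.exists_isReduced (cs.wordProd ω * cs.simple i)
  have key : signedConjHom cs (cs.wordProd ω') (cs.simple i, 0) =
      signedConjHom cs (cs.wordProd ω) (signedConj cs i (cs.simple i, 0)) := by
    rw [← hprod, map_mul, end_mul_apply, signedConjHom_simple]
  simp only [signedConj, signedConjHom_wordProd, Prod.mk.injEq, List.count_eq_zero.mpr hmem,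
    if_true, cs.simple_mul_simple_self, one_mul] at key
  have hmem' : cs.simple i ∈ cs.rightInvSeq ω' := by
    by_contra hn
    simp [List.count_eq_zero.mpr hn] at key
  have hlt := (cs.isRightInversion_of_mem_rightInvSeq hω' hmem').2
  rw [← hprod, cs.simple_mul_simple_cancel_right] at hlt
  exact lt_asymm h hlt

/-- The exchange property. -/
theorem exists_wordProd_mul_simple_eq_eraseIdx {ω : List B} {i : B}
    (h : cs.IsRightDescent (cs.wordProd ω) i) :
    ∃ k < ω.length, cs.wordProd ω * cs.simple i = cs.wordProd (ω.eraseIdx k) := by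
  obtain ⟨k, hk, hk'⟩ := List.getElem_of_mem (simple_mem_rightInvSeq cs h)
  refine ⟨k, by simpa using hk, ?_⟩
  rw [← cs.wordProd_mul_getD_rightInvSeq, List.getD_eq_getElem _ _ hk, hk']

/-- The linear form of the geometric representation attached to a simple reflection. -/
noncomputable def simpleCoroot (M : CoxeterMatrix B) (i : B) : Module.Dual ℝ (B →₀ ℝ) :=
  Finsupp.linearCombination ℝ fun j => -2 * Real.cos (Real.pi / M i j)

theorem simpleCoroot_single (M : CoxeterMatrix B) (i j : B) :
    simpleCoroot M i (Finsupp.single j 1) = -2 * Real.cos (Real.pi / M i j) := by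
  simp [simpleCoroot]

theorem simpleCoroot_single_self (M : CoxeterMatrix B) (i : B) :
    simpleCoroot M i (Finsupp.single i 1) = 2 := by
  simp [simpleCoroot_single]

theorem isLiftable_reflection (M : CoxeterMatrix B) :
    M.IsLiftable fun i => Module.reflection (simpleCoroot_single_self M i) := by
  intro i j
  obtain hij | hij := eq_or_ne i j
  · subst hij
    ext1 v
    simp [Module.involutive_reflection _ v]
  obtain hm | hm := Nat.eq_zero_or_pos (M i j)
  · simp [hm]
  have hm1 : M i j ≠ 1 := M.off_diagonal i j hij
  have hsymm : M j i = M i j := M.symmetric j i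
  ext1 v
  rw [Module.reflection_mul_reflection_pow_apply _ _ _ _ _ rfl]
  simp only [simpleCoroot_single, hsymm]
  generalize hM : M i j = m at *
  set θ : ℝ := Real.pi / m with hθ
  have hmθ : (m : ℝ) * θ = Real.pi := by rw [hθ]; field_simp
  rw [show -2 * Real.cos θ * (-2 * Real.cos θ) - 2 = 2 * Real.cos (2 * θ) by
    rw [Real.cos_two_mul]; ring]
  obtain rfl | hm2 := eq_or_ne m 2
  · have : Real.cos θ = 0 := by rw [hθ]; simp
    have h2 : Real.cos (2 * θ) = -1 := by rw [Real.cos_two_mul, this]; norm_num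
    simp [this, h2]
    module
  have hm3 : (3 : ℝ) ≤ m := by exact_mod_cast (by omega : 3 ≤ m)
  have hsin : Real.sin (2 * θ) ≠ 0 := by
    apply (Real.sin_pos_of_pos_of_lt_pi _ _).ne'
    · positivity
    · rw [hθ, ← mul_div_assoc, div_lt_iff₀ (by linarith)]
      nlinarith [Real.pi_pos]
  have hS (n : ℤ) := Polynomial.Chebyshev.S_two_mul_real_cos (2 * θ) n
  obtain ⟨k, rfl | rfl⟩ := Nat.even_or_odd' m
  · have h0 : (Polynomial.Chebyshev.S ℝ (k - 1 : ℤ)).eval (2 * Real.cos (2 * θ)) = 0 := by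
      refine (mul_eq_zero.mp ((hS _).trans ?_)).resolve_right hsin
      push_cast at hmθ ⊢
      rw [show ((k : ℝ) - 1 + 1) * (2 * θ) = Real.pi by linarith, Real.sin_pi]
    rw [show (((2 * k : ℕ) : ℤ) - 2) / 2 = k - 1 by omega,
      show (((2 * k : ℕ) : ℤ) - 1) / 2 = k - 1 by omega, h0]
    simp
  · have h0 : (Polynomial.Chebyshev.S ℝ (k : ℤ)).eval (2 * Real.cos (2 * θ)) +
        (Polynomial.Chebyshev.S ℝ (k - 1 : ℤ)).eval (2 * Real.cos (2 * θ)) = 0 := by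
      refine (mul_eq_zero.mp ?_).resolve_right hsin
      rw [add_mul, hS, hS]
      push_cast at hmθ ⊢
      rw [show ((k : ℝ) + 1) * (2 * θ) = Real.pi + θ by linarith,
        show ((k : ℝ) - 1 + 1) * (2 * θ) = Real.pi - θ by linarith, Real.sin_pi_sub,
        add_comm Real.pi, Real.sin_add_pi]
      ring
    rw [show (((2 * k + 1 : ℕ) : ℤ) - 2) / 2 = k - 1 by omega,
      show (((2 * k + 1 : ℕ) : ℤ) - 1) / 2 = k by omega,
      show (((2 * k + 1 : ℕ) : ℤ) - 3) / 2 = k - 1 by omega,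
      show (((2 * k + 1 : ℕ) : ℤ)) / 2 = k by omega, h0]
    simp

theorem simple_injective : Function.Injective cs.simple := by
  intro i j h
  by_contra hij
  have h1 := congrArg (cs.lift ⟨_, isLiftable_reflection M⟩) h
  rw [cs.lift_apply_simple (isLiftable_reflection M),
    cs.lift_apply_simple (isLiftable_reflection M)] at h1
  have h2 := congrArg (fun v : B →₀ ℝ => v i) (LinearEquiv.congr_fun h1 (Finsupp.single i 1))
  simp only [Module.reflection_apply, simpleCoroot_single_self] at h2
  simp [Ne.symm hij] at h2

theorem wordProd_mem_parab {I : Set B} {ω : List B} (h : ∀ i ∈ ω, i ∈ I) :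
    cs.wordProd ω ∈ parab cs I := by
  refine Subgroup.list_prod_mem _ fun x hx => ?_
  obtain ⟨i, hi, rfl⟩ := List.mem_map.mp hx
  exact Subgroup.subset_closure ⟨i, h i hi, rfl⟩

theorem simple_mem_parab {I : Set B} {i : B} (hi : i ∈ I) : cs.simple i ∈ parab cs I :=
  Subgroup.subset_closure ⟨i, hi, rfl⟩

theorem parab_mono {I J : Set B} (h : I ⊆ J) : parab cs I ≤ parab cs J :=
  Subgroup.closure_mono (Set.image_mono h)

theorem isReduced_append_singleton {ω : List B} {i : B} (hω : cs.IsReduced ω)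
    (h : ¬ cs.IsRightDescent (cs.wordProd ω) i) : cs.IsReduced (ω ++ [i]) := by
  rw [CoxeterSystem.IsReduced, cs.wordProd_append, cs.wordProd_singleton,
    cs.not_isRightDescent_iff.mp h, hω.eq]
  simp

theorem exists_isReduced_of_mem_parab {I : Set B} {w : W} (hw : w ∈ parab cs I) :
    ∃ ω : List B, cs.IsReduced ω ∧ (∀ i ∈ ω, i ∈ I) ∧ cs.wordProd ω = w := by
  have step : ∀ x : W, ∀ i ∈ I,
      (∃ ω : List B, cs.IsReduced ω ∧ (∀ j ∈ ω, j ∈ I) ∧ cs.wordProd ω = x) →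
      ∃ ω : List B, cs.IsReduced ω ∧ (∀ j ∈ ω, j ∈ I) ∧ cs.wordProd ω = x * cs.simple i := by
    rintro _ i hi ⟨ω, hω, hωI, rfl⟩
    by_cases h : cs.IsRightDescent (cs.wordProd ω) i
    · obtain ⟨k, hk, hprod⟩ := exists_wordProd_mul_simple_eq_eraseIdx cs h
      refine ⟨ω.eraseIdx k, ?_, fun j hj => hωI j (List.mem_of_mem_eraseIdx hj), hprod.symm⟩
      have h1 := cs.isRightDescent_iff.mp h
      rw [hprod, hω.eq] at h1
      have h2 := List.length_eraseIdx_add_one hk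
      rw [CoxeterSystem.IsReduced]
      omega
    · refine ⟨ω ++ [i], isReduced_append_singleton cs hω h, ?_, ?_⟩
      · simpa [or_imp, forall_and] using ⟨hωI, hi⟩
      · simp [cs.wordProd_append]
  induction hw using Subgroup.closure_induction_right with
  | one => exact ⟨[], by simp [CoxeterSystem.IsReduced]⟩
  | mul_right x _ y hy ih =>
    obtain ⟨i, hi, rfl⟩ := hy
    exact step x i hi ih
  | mul_inv_cancel x _ y hy ih =>
    obtain ⟨i, hi, rfl⟩ := hy
    rw [cs.inv_simple]
    exact step x i hi ih

theorem isReduced_of_append_singleton {ω : List B} {i : B} (h : cs.IsReduced (ω ++ [i])) :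
    cs.IsReduced ω ∧ ¬ cs.IsRightDescent (cs.wordProd ω) i := by
  have h1 := h.eq
  rw [cs.wordProd_append, cs.wordProd_singleton, List.length_append, List.length_singleton] at h1
  have h2 := cs.length_wordProd_le ω
  have h3 := cs.length_mul_simple (cs.wordProd ω) i
  rw [cs.not_isRightDescent_iff, CoxeterSystem.IsReduced]
  omega

/-- Induction on a parabolic subgroup along length-increasing multiplications on the right. -/
theorem parab_induction {I : Set B} {p : W → Prop} (one : p 1)
    (mul : ∀ v ∈ parab cs I, ∀ i ∈ I, ¬ cs.IsRightDescent v i → p v → p (v * cs.simple i))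
    {v : W} (hv : v ∈ parab cs I) : p v := by
  obtain ⟨ω, hω, hωI, rfl⟩ := exists_isReduced_of_mem_parab cs hv
  clear hv
  induction ω using List.reverseRecOn with
  | nil => simpa using one
  | append_singleton ω i ih =>
    obtain ⟨h1, h2⟩ := isReduced_of_append_singleton cs hω
    have h3 : ∀ j ∈ ω, j ∈ I := fun j hj => hωI j (by simp [hj])
    rw [cs.wordProd_append, cs.wordProd_singleton]
    exact mul _ (wordProd_mem_parab cs h3) i (hωI i (by simp)) h2 (ih h1 h3)

theorem mem_of_simple_mem_parab {I : Set B} {i : B} (h : cs.simple i ∈ parab cs I) : i ∈ I := by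
  obtain ⟨ω, hω, hωI, hprod⟩ := exists_isReduced_of_mem_parab cs h
  have h1 := hω.eq
  rw [hprod, cs.length_simple] at h1
  obtain ⟨j, rfl⟩ := List.length_eq_one_iff.mp h1.symm
  rw [cs.wordProd_singleton] at hprod
  exact simple_injective cs hprod ▸ hωI j (by simp)

theorem mem_of_isReduced_of_wordProd_mem_parab {I : Set B} {ω : List B} (hω : cs.IsReduced ω)
    (h : cs.wordProd ω ∈ parab cs I) : ∀ i ∈ ω, i ∈ I := by
  induction ω using List.reverseRecOn with
  | nil => simp
  | append_singleton ω i ih =>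
    obtain ⟨h1, h2⟩ := isReduced_of_append_singleton cs hω
    rw [cs.wordProd_append, cs.wordProd_singleton] at h
    rw [cs.isRightDescent_iff_not_isRightDescent_mul, not_not] at h2
    obtain ⟨ω', -, hωI, hprod⟩ := exists_isReduced_of_mem_parab cs h
    rw [← hprod] at h2
    obtain ⟨k, hk, herase⟩ := exists_wordProd_mul_simple_eq_eraseIdx cs h2
    rw [hprod, cs.simple_mul_simple_cancel_right] at herase
    have hmem : cs.wordProd ω ∈ parab cs I := by
      rw [herase]
      exact wordProd_mem_parab cs fun j hj => hωI j (List.mem_of_mem_eraseIdx hj)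
    have hi := mem_of_simple_mem_parab cs (((parab cs I).mul_mem_cancel_left hmem).mp h)
    simpa [or_imp, forall_and] using ⟨ih h1 hmem, hi⟩

theorem supp_subset_of_mem_parab {I : Set B} {w : W} (hw : w ∈ parab cs I) : supp cs w ⊆ I := by
  rintro i ⟨ω, hω, rfl, hi⟩
  exact mem_of_isReduced_of_wordProd_mem_parab cs hω hw i hi

theorem mem_parab_supp (w : W) : w ∈ parab cs (supp cs w) := by
  obtain ⟨ω, hω, rfl⟩ := cs.exists_isReduced w
  exact wordProd_mem_parab cs fun i hi => ⟨ω, hω, rfl, hi⟩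

theorem mem_supp_of_isRightDescent {w : W} {i : B} (h : cs.IsRightDescent w i) :
    i ∈ supp cs w := by
  obtain ⟨ω, hω, hprod⟩ := cs.exists_isReduced (w * cs.simple i)
  rw [cs.isRightDescent_iff_not_isRightDescent_mul, hprod] at h
  refine ⟨ω ++ [i], isReduced_append_singleton cs hω h, ?_, by simp⟩
  rw [cs.wordProd_append, ← hprod, cs.wordProd_singleton, cs.simple_mul_simple_cancel_right]

theorem supp_mul {a b : W} (h : cs.length (a * b) = cs.length a + cs.length b) :
    supp cs (a * b) = supp cs a ∪ supp cs b := by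
  apply subset_antisymm
  · exact supp_subset_of_mem_parab cs (mul_mem
      (parab_mono cs Set.subset_union_left (mem_parab_supp cs a))
      (parab_mono cs Set.subset_union_right (mem_parab_supp cs b)))
  · have append : ∀ ω ω' : List B, cs.IsReduced ω → cs.IsReduced ω' → cs.wordProd ω = a →
        cs.wordProd ω' = b → cs.IsReduced (ω ++ ω') ∧ cs.wordProd (ω ++ ω') = a * b := by
      rintro ω ω' hω hω' rfl rfl
      rw [CoxeterSystem.IsReduced, cs.wordProd_append, h, hω.eq, hω'.eq]
      simp
    rintro i (⟨ω, hω, hprod, hi⟩ | ⟨ω, hω, hprod, hi⟩)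
    · obtain ⟨ω', hω', hprod'⟩ := cs.exists_isReduced b
      obtain ⟨h1, h2⟩ := append ω ω' hω hω' hprod hprod'.symm
      exact ⟨_, h1, h2, by simp [hi]⟩
    · obtain ⟨ω', hω', hprod'⟩ := cs.exists_isReduced a
      obtain ⟨h1, h2⟩ := append ω' ω hω' hω hprod'.symm hprod
      exact ⟨_, h1, h2, by simp [hi]⟩

/-- The exchange property for a product whose right factor does not have the given descent. -/
theorem exists_length_lt_mul_simple_eq_mul {x v : W} {i : B} (h : cs.IsRightDescent (x * v) i)
    (hv : ¬ cs.IsRightDescent v i) :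
    ∃ y : W, cs.length y < cs.length x ∧ x * v * cs.simple i = y * v := by
  obtain ⟨ω, hω, rfl⟩ := cs.exists_isReduced x
  obtain ⟨ω', hω', rfl⟩ := cs.exists_isReduced v
  rw [← cs.wordProd_append] at h
  obtain ⟨k, hk, hprod⟩ := exists_wordProd_mul_simple_eq_eraseIdx cs h
  rw [← cs.wordProd_append, hprod]
  obtain hlt | hle := lt_or_ge k ω.length
  · refine ⟨cs.wordProd (ω.eraseIdx k), ?_, ?_⟩
    · have h1 := cs.length_wordProd_le (ω.eraseIdx k)
      have h2 := List.length_eraseIdx_add_one hlt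
      rw [hω.eq]
      omega
    · rw [List.eraseIdx_append_of_lt_length hlt, cs.wordProd_append]
  · exfalso
    rw [List.eraseIdx_append_of_length_le hle, cs.wordProd_append, cs.wordProd_append, mul_assoc,
      mul_right_inj] at hprod
    rw [cs.not_isRightDescent_iff, hprod, hω'.eq] at hv
    have h1 := cs.length_wordProd_le (ω'.eraseIdx (k - ω.length))
    have h2 := List.length_eraseIdx_le ω' (k - ω.length)
    omega

theorem length_mul_of_forall_length_le {I : Set B} {x v : W}
    (hx : ∀ u ∈ parab cs I, cs.length x ≤ cs.length (x * u)) (hv : v ∈ parab cs I) :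
    cs.length (x * v) = cs.length x + cs.length v := by
  refine parab_induction cs (p := fun v => cs.length (x * v) = cs.length x + cs.length v)
    (by simp) (fun v hv i hi hvi ih => ?_) hv
  have hxv : ¬ cs.IsRightDescent (x * v) i := by
    intro h
    obtain ⟨y, hy, hprod⟩ := exists_length_lt_mul_simple_eq_mul cs h hvi
    have h1 := hx (v * cs.simple i * v⁻¹)
      (mul_mem (mul_mem hv (simple_mem_parab cs hi)) (inv_mem hv))
    rw [← mul_assoc, ← mul_assoc, hprod, mul_inv_cancel_right] at h1
    exact absurd h1 hy.not_ge
  rw [← mul_assoc, cs.not_isRightDescent_iff.mp hxv, cs.not_isRightDescent_iff.mp hvi, ih,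
    add_assoc]

theorem length_mul_of_isMinRep {I : Set B} {x v : W} (hx : IsMinRep cs I x)
    (hv : v ∈ parab cs I) : cs.length (x * v) = cs.length x + cs.length v := by
  obtain ⟨u, hu, hmin⟩ := (measure fun u => cs.length (x * u)).wf.has_min
    (parab cs I : Set W) ⟨1, one_mem _⟩
  have hmin' : ∀ t ∈ parab cs I, cs.length (x * u) ≤ cs.length (x * u * t) := fun t ht => by
    rw [mul_assoc]
    exact not_lt.mp (hmin (u * t) (mul_mem hu ht))
  have hadd := length_mul_of_forall_length_le cs hmin' (inv_mem hu)
  rw [mul_inv_cancel_right] at hadd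
  obtain rfl : u = 1 := by
    by_contra hne
    obtain ⟨i, hi⟩ := cs.exists_rightDescent_of_ne_one (inv_ne_one.mpr hne)
    have hiI := supp_subset_of_mem_parab cs (inv_mem hu) (mem_supp_of_isRightDescent cs hi)
    refine hx i hiI ?_
    have h1 := cs.length_mul_le (x * u) (u⁻¹ * cs.simple i)
    rw [← mul_assoc, mul_inv_cancel_right] at h1
    unfold CoxeterSystem.IsRightDescent at hi ⊢
    omega
  rw [mul_one] at hmin'
  exact length_mul_of_forall_length_le cs hmin' hv

theorem pHigh_mul {I : Set B} {x v : W} (hx : IsMinRep cs I x) (hv : v ∈ parab cs I) :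
    pHigh cs I (x * v) = x := by
  have hspec : pLow cs I (x * v) ∈ parab cs I ∧ IsMinRep cs I (x * v * (pLow cs I (x * v))⁻¹) ∧
      cs.length (x * v) =
        cs.length (x * v * (pLow cs I (x * v))⁻¹) + cs.length (pLow cs I (x * v)) :=
    Classical.epsilon_spec (p := fun u => u ∈ parab cs I ∧ IsMinRep cs I (x * v * u⁻¹) ∧
      cs.length (x * v) = cs.length (x * v * u⁻¹) + cs.length u)
      ⟨v, hv, by rwa [mul_inv_cancel_right], by
        rw [mul_inv_cancel_right, length_mul_of_isMinRep cs hx hv]⟩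
  obtain ⟨hu, hmin, -⟩ := hspec
  rw [pHigh]
  generalize pLow cs I (x * v) = u at *
  have h1 := length_mul_of_isMinRep cs hx (mul_mem hv (inv_mem hu))
  have h2 := length_mul_of_isMinRep cs hmin (mul_mem hu (inv_mem hv))
  rw [show x * v * u⁻¹ * (u * v⁻¹) = x by group] at h2
  rw [← mul_assoc] at h1
  have h3 : v * u⁻¹ = 1 := by
    rw [← cs.length_eq_zero_iff]
    omega
  rw [mul_assoc, h3, mul_one]

theorem longestElt_spec [Finite W] (I : Set B) :
    longestElt cs I ∈ parab cs I ∧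
      ∀ y ∈ parab cs I, cs.length y ≤ cs.length (longestElt cs I) :=
  Classical.epsilon_spec (p := fun x => x ∈ parab cs I ∧
      ∀ y ∈ parab cs I, cs.length y ≤ cs.length x)
    (Set.exists_max_image (parab cs I : Set W) cs.length (Set.toFinite _) ⟨1, one_mem _⟩)

theorem isRightDescent_longestElt [Finite W] {I : Set B} {i : B} (hi : i ∈ I) :
    cs.IsRightDescent (longestElt cs I) i := by
  obtain ⟨h1, h2⟩ := longestElt_spec cs I
  exact lt_of_le_of_ne (h2 _ (mul_mem h1 (simple_mem_parab cs hi))) (cs.length_mul_simple_ne _ i)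

theorem supp_longestElt [Finite W] (I : Set B) : supp cs (longestElt cs I) = I :=
  subset_antisymm (supp_subset_of_mem_parab cs (longestElt_spec cs I).1)
    fun _ hi => mem_supp_of_isRightDescent cs (isRightDescent_longestElt cs hi)

/-- If every element of `I` is a right descent of `w`, then `w` has every element of `W_I` as a
suffix. -/
theorem length_mul_inv_add_length {I : Set B} {w u : W}
    (hw : ∀ i ∈ I, cs.IsRightDescent w i) (hu : u ∈ parab cs I) :
    cs.length (w * u⁻¹) + cs.length u = cs.length w := by
  refine parab_induction cs (p := fun u => cs.length (w * u⁻¹) + cs.length u = cs.length w)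
    (by simp) (fun u hu i hi hui ih => ?_) hu
  have hwi := hw i hi
  rw [← inv_mul_cancel_right w u] at hwi
  obtain ⟨y, hy, hprod⟩ := exists_length_lt_mul_simple_eq_mul cs hwi hui
  rw [inv_mul_cancel_right, ← mul_inv_eq_iff_eq_mul] at hprod
  have h1 := cs.length_mul_le (w * (u * cs.simple i)⁻¹) (u * cs.simple i)
  rw [inv_mul_cancel_right, cs.not_isRightDescent_iff.mp hui] at h1
  rw [cs.not_isRightDescent_iff.mp hui]
  rw [mul_inv_rev, cs.inv_simple, ← mul_assoc, hprod] at h1 ⊢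
  omega

theorem isMinRep_mul_inv_longestElt [Finite W] {I : Set B} {w : W}
    (hw : ∀ i ∈ I, cs.IsRightDescent w i) : IsMinRep cs I (w * (longestElt cs I)⁻¹) := by
  intro i hi h
  obtain ⟨h1, h2⟩ := longestElt_spec cs I
  have h3 := length_mul_inv_add_length cs hw h1
  have h4 := h2 _ (mul_mem (simple_mem_parab cs hi) h1)
  have h5 := cs.length_mul_le (w * (longestElt cs I)⁻¹ * cs.simple i)
    (cs.simple i * longestElt cs I)
  rw [← mul_assoc, cs.simple_mul_simple_cancel_right, inv_mul_cancel_right] at h5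
  unfold CoxeterSystem.IsRightDescent at h
  omega

/-- **Lemma (central).** For `I ⊆ J ⊆ S`, the map `ψ : w ↦ w^I` is a bijection from
`E_σ(I,J)` to `E_β(I,J)`, with inverse `φ : u ↦ u * w_{∘,I}`. -/
theorem lemme_central [Finite W] (I J : Set B) (hIJ : I ⊆ J) :
    Set.BijOn (pHigh cs I) (Es cs I J) (Eb cs I J) ∧
      Set.InvOn (fun u : W => u * longestElt cs I) (pHigh cs I) (Es cs I J) (Eb cs I J) := by
  obtain ⟨hlong, -⟩ := longestElt_spec cs I
  have pHigh_eq : ∀ w ∈ Es cs I J, pHigh cs I w = w * (longestElt cs I)⁻¹ := by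
    rintro w ⟨-, -, hw, -⟩
    have h := pHigh_mul cs (isMinRep_mul_inv_longestElt cs hw) hlong
    rwa [inv_mul_cancel_right] at h
  have hinv : Set.InvOn (fun u : W => u * longestElt cs I) (pHigh cs I)
      (Es cs I J) (Eb cs I J) := by
    refine ⟨fun w hw => ?_, fun u hu => pHigh_mul cs hu.2.1 hlong⟩
    simp only [pHigh_eq w hw, inv_mul_cancel_right]
  refine ⟨hinv.bijOn (fun w hw => ?_) fun u hu => ?_, hinv⟩
  · rw [pHigh_eq w hw]
    obtain ⟨hwJ, hsupp, hdesc, -⟩ := hw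
    refine ⟨mul_mem hwJ (inv_mem (parab_mono cs hIJ hlong)),
      isMinRep_mul_inv_longestElt cs hdesc, ?_⟩
    have h := supp_mul cs (a := w * (longestElt cs I)⁻¹) (b := longestElt cs I) (by
      rw [inv_mul_cancel_right, length_mul_inv_add_length cs hdesc hlong])
    rw [inv_mul_cancel_right, hsupp, supp_longestElt] at h
    rw [Set.sdiff_subset_iff, h, Set.union_comm]
  · obtain ⟨huJ, hmin, hsub⟩ := hu
    have hsupp : supp cs (u * longestElt cs I) = J := by
      rw [supp_mul cs (length_mul_of_isMinRep cs hmin hlong), supp_longestElt]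
      refine subset_antisymm (Set.union_subset (supp_subset_of_mem_parab cs huJ) hIJ) ?_
      rwa [Set.union_comm, ← Set.sdiff_subset_iff]
    refine ⟨mul_mem huJ (parab_mono cs hIJ hlong), hsupp, fun i hi => ?_,
      fun i hi => hsupp ▸ mem_supp_of_isRightDescent cs hi⟩
    have h := isRightDescent_longestElt cs hi
    unfold CoxeterSystem.IsRightDescent at h ⊢
    rw [mul_assoc, length_mul_of_isMinRep cs hmin hlong,
      length_mul_of_isMinRep cs hmin (mul_mem hlong (simple_mem_parab cs hi))]
    omega

end ShardBHZ
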